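/- Let Λ be an integral domain of characteristic zero, let n ≥ 1, and let g₁, …, g_r be nonzero formal power series in Λ[[x₁, …, xₙ]]. For each j let p_j = ω(g_j) be the order of g_j, i.e. the smallest total degree of a nonzero homogeneous component of g_j. Then there exist integers ν₁, …, ν_{n−1} ∈ ℤ such that, under the substitution σ sending x_i ↦ x_i + ν_i·xₙ for 1 ≤ i ≤ n−1 and xₙ ↦ xₙ, each series g_j ∘ σ is regular of order p_j with respect to xₙ: that is, in g_j ∘ σ the coefficient of the pure monomial xₙ^m is zero for all m < p_j, and the coefficient of xₙ^{p_j} is nonzero. -/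

import Mathlib

open MvPowerSeries

/-- For a formal power series `g ∈ Λ[[x₁, …, x_{m+1}]]` with homogeneous decomposition
`g = ∑_d g_d`, this is the value `g_d(w)` of the homogeneous component of degree `d` of
`g` at the point `w ∈ Λ^{m+1}`, i.e. `∑_{|α| = d} (coeff α g) · wᵅ`. -/
noncomputable def homogeneousComponentEval {Λ : Type*} [CommRing Λ] {m : ℕ}
    (g : MvPowerSeries (Fin (m + 1)) Λ) (w : Fin (m + 1) → Λ) (d : ℕ) : Λ :=
  ∑ α ∈ Finset.Nat.antidiagonalTuple (m + 1) d,
    MvPowerSeries.coeff (Finsupp.equivFunOnFinite.symm α) g * ∏ i, w i ^ α i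

/-- A nonzero polynomial over a domain of characteristic zero does not vanish at some integer
point. -/
theorem MvPolynomial.exists_eval_intCast_ne_zero {R σ : Type*} [CommRing R] [IsDomain R]
    [CharZero R] {F : MvPolynomial σ R} (hF : F ≠ 0) :
    ∃ ν : σ → ℤ, MvPolynomial.eval (fun i => (ν i : R)) F ≠ 0 := by
  by_contra! h
  refine hF (MvPolynomial.funext_set (fun _ => Set.range ((↑) : ℤ → R))
    (fun _ => Set.infinite_range_of_injective Int.cast_injective) fun x hx => ?_)
  choose ν hν using fun i => hx i (Set.mem_univ i)
  obtain rfl : (fun i => (ν i : R)) = x := _root_.funext hν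
  rw [map_zero, h ν]

/-- The homogeneous component of degree `d` of `g`, with the last variable set to `1`. -/
noncomputable def dehomogenizedComponent {Λ : Type*} [CommRing Λ] {m : ℕ}
    (g : MvPowerSeries (Fin (m + 1)) Λ) (d : ℕ) : MvPolynomial (Fin m) Λ :=
  ∑ α ∈ Finset.Nat.antidiagonalTuple (m + 1) d,
    MvPolynomial.monomial (Finsupp.equivFunOnFinite.symm (Fin.init α))
      (MvPowerSeries.coeff (Finsupp.equivFunOnFinite.symm α) g)

theorem eval_dehomogenizedComponent {Λ : Type*} [CommRing Λ] {m : ℕ}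
    (g : MvPowerSeries (Fin (m + 1)) Λ) (d : ℕ) (v : Fin m → Λ) :
    MvPolynomial.eval v (dehomogenizedComponent g d) =
      homogeneousComponentEval g (Fin.snoc v (1 : Λ)) d := by
  simp only [dehomogenizedComponent, homogeneousComponentEval, map_sum]
  refine Finset.sum_congr rfl fun α _ => ?_
  rw [MvPolynomial.eval_monomial, Finsupp.prod_fintype _ _ fun _ => pow_zero _]
  simp [Fin.prod_univ_castSucc, Fin.init]

theorem coeff_dehomogenizedComponent {Λ : Type*} [CommRing Λ] {m : ℕ}
    (g : MvPowerSeries (Fin (m + 1)) Λ) (α : Fin (m + 1) →₀ ℕ) :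
    MvPolynomial.coeff (Finsupp.equivFunOnFinite.symm (Fin.init α))
      (dehomogenizedComponent g (∑ i, α i)) = MvPowerSeries.coeff α g := by
  classical
  simp only [dehomogenizedComponent, MvPolynomial.coeff_sum, MvPolynomial.coeff_monomial]
  rw [Finset.sum_eq_single (α : Fin (m + 1) → ℕ)]
  · simp
  · intro β hβ hne
    refine if_neg fun h => hne ?_
    have hinit : Fin.init β = Fin.init (α : Fin (m + 1) → ℕ) :=
      Finsupp.equivFunOnFinite.symm.injective h
    have hcast (i : Fin m) : β i.castSucc = α i.castSucc := congrFun hinit i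
    have hsum := Finset.Nat.mem_antidiagonalTuple.mp hβ
    simp only [Fin.sum_univ_castSucc, hcast] at hsum
    funext i
    exact Fin.lastCases (Nat.add_left_cancel hsum) hcast i
  · intro h
    exact absurd (Finset.Nat.mem_antidiagonalTuple.mpr rfl) h

theorem homogeneousComponentEval_eq_zero {Λ : Type*} [CommRing Λ] {m : ℕ}
    {g : MvPowerSeries (Fin (m + 1)) Λ} {d : ℕ}
    (h : ∀ α : Fin (m + 1) →₀ ℕ, ∑ i, α i = d → MvPowerSeries.coeff α g = 0)
    (w : Fin (m + 1) → Λ) : homogeneousComponentEval g w d = 0 := by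
  refine Finset.sum_eq_zero fun α hα => ?_
  rw [h _ (Finset.Nat.mem_antidiagonalTuple.mp hα), zero_mul]

/-- Lemma 5.1 of the paper.
Let `Λ` be an integral domain of characteristic zero and `g₁, …, g_r` nonzero formal
power series in `n = m + 1` variables over `Λ`, with `p_j = ω(g_j)` the order of `g_j`
(smallest total degree of a nonzero coefficient).  Then there are integers
`ν₁, …, ν_{n−1}` such that, under the substitution `σ : x_i ↦ x_i + ν_i·xₙ` (`i < n`),
`xₙ ↦ xₙ`, every `g_j ∘ σ` is regular of order `p_j` in `xₙ`: the coefficient of `xₙ^d`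
in `g_j ∘ σ` — which equals `(g_j)_d(ν₁, …, ν_{n−1}, 1)`, the evaluation of the degree-`d`
homogeneous component of `g_j` at `(ν, 1)` — vanishes for `d < p_j` and is nonzero for
`d = p_j`. -/
theorem exists_linear_change_regular
    (Λ : Type*) [CommRing Λ] [IsDomain Λ] [CharZero Λ]
    (m r : ℕ) (g : Fin r → MvPowerSeries (Fin (m + 1)) Λ) (p : Fin r → ℕ)
    (h_ord : ∀ j : Fin r,
      (∃ α : Fin (m + 1) →₀ ℕ, (∑ i, α i) = p j ∧ MvPowerSeries.coeff α (g j) ≠ 0) ∧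
      ∀ α : Fin (m + 1) →₀ ℕ, (∑ i, α i) < p j → MvPowerSeries.coeff α (g j) = 0) :
    ∃ ν : Fin m → ℤ, ∀ j : Fin r,
      (∀ d < p j,
        homogeneousComponentEval (g j) (Fin.snoc (fun i => (ν i : Λ)) (1 : Λ)) d = 0) ∧
      homogeneousComponentEval (g j) (Fin.snoc (fun i => (ν i : Λ)) (1 : Λ)) (p j) ≠ 0 := by
  have hF : ∏ j, dehomogenizedComponent (g j) (p j) ≠ 0 := by
    refine Finset.prod_ne_zero_iff.mpr fun j _ h0 => ?_
    obtain ⟨α, hα, hne⟩ := (h_ord j).1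
    apply hne
    rw [← coeff_dehomogenizedComponent, hα, h0, MvPolynomial.coeff_zero]
  obtain ⟨ν, hν⟩ := MvPolynomial.exists_eval_intCast_ne_zero hF
  refine ⟨ν, fun j => ⟨fun d hd => homogeneousComponentEval_eq_zero
    (fun α hα => (h_ord j).2 α (hα.trans_lt hd)) _, ?_⟩⟩
  rw [map_prod] at hν
  rw [← eval_dehomogenizedComponent]
  exact Finset.prod_ne_zero_iff.mp hν j (Finset.mem_univ j)
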